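/- Let a > 0 and 0 < ε < 1. Then there exist positive constants K_1 and m_0 depending only on a, and δ_0 > 0 depending on a and ε, such that for every z = x + iy ∈ V_a with |z| ≤ δ_0 and every integer m ≥ m_0 one has sinh²((1−ε)mx) ≤ |D_m(z)| ≤ K_1·sinh²((1+ε)mx). -/

import Mathlib

open Complex

/-- The wedge `V_a = {z = x + iy ∈ ℂ : x > 0, |y| < a·x}`. -/
def wedge (a : ℝ) : Set ℂ := {z : ℂ | 0 < z.re ∧ |z.im| < a * z.re}

/-- The denominator function
`D_m(z) = ((1+z)/2)((1+z)/(1-z))^m + ((1-z)/2)((1-z)/(1+z))^m - 1`. -/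
noncomputable def Dm (m : ℕ) (z : ℂ) : ℂ :=
  (1 + z) / 2 * ((1 + z) / (1 - z)) ^ m + (1 - z) / 2 * ((1 - z) / (1 + z)) ^ m - 1

/-- The squared norm of `sinh` in terms of real and imaginary parts. -/
lemma norm_sinh_sq (s : ℂ) :
    ‖Complex.sinh s‖ ^ 2 = Real.sinh s.re ^ 2 + Real.sin s.im ^ 2 := by
  have h : Complex.sinh s = ((Real.sinh s.re * Real.cos s.im : ℝ) : ℂ)
      + ((Real.cosh s.re * Real.sin s.im : ℝ) : ℂ) * I := by
    conv_lhs => rw [← Complex.re_add_im s]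
    rw [Complex.sinh_add, Complex.sinh_mul_I, Complex.cosh_mul_I]
    push_cast
    ring
  rw [h, ← Complex.normSq_eq_norm_sq, Complex.normSq_add_mul_I, mul_pow, mul_pow, Real.cosh_sq,
    Real.cos_sq']
  ring

lemma sinh_re_le_norm_sinh (s : ℂ) : Real.sinh s.re ≤ ‖Complex.sinh s‖ := by
  refine le_of_sq_le_sq ?_ (norm_nonneg _)
  rw [norm_sinh_sq]
  nlinarith [sq_nonneg (Real.sin s.im)]

/-- On the wedge `|Im s| ≤ C Re s`, the norm of `sinh s` is controlled by `sinh (Re s)`. -/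
lemma norm_sinh_le {C : ℝ} (hC : 0 ≤ C) {s : ℂ} (hs : 0 ≤ s.re) (h : |s.im| ≤ C * s.re) :
    ‖Complex.sinh s‖ ≤ (1 + C) * Real.sinh s.re := by
  have h1 : s.re ≤ Real.sinh s.re := Real.self_le_sinh_iff.2 hs
  have h2 : |Real.sin s.im| ≤ C * Real.sinh s.re :=
    (Real.abs_sin_le_abs).trans (h.trans (by gcongr))
  have h0 : 0 ≤ Real.sinh s.re := hs.trans h1
  refine le_of_sq_le_sq ?_ (by positivity)
  have h3 := pow_le_pow_left₀ (abs_nonneg _) h2 2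
  rw [sq_abs] at h3
  rw [norm_sinh_sq]
  nlinarith [mul_nonneg hC (sq_nonneg (Real.sinh s.re))]

lemma sinh_add_one_mul_le {m σ : ℝ} (hm : 1 ≤ m) (hσ : 0 ≤ σ) :
    Real.sinh ((m + 1) * σ) ≤ 2 * Real.sinh (m * σ) * Real.cosh σ := by
  have h : 0 ≤ Real.sinh ((m - 1) * σ) :=
    Real.sinh_nonneg_iff.2 (mul_nonneg (by linarith) hσ)
  rw [sub_mul, one_mul, Real.sinh_sub] at h
  rw [add_mul, one_mul, Real.sinh_add]
  linarith

/-- If `s = artanh z`, then `D_m(z) cosh s = 2 sinh (m s) sinh ((m + 1) s)`. -/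
lemma Dm_mul_cosh (m : ℕ) {z s : ℂ} (hz : 1 - z ≠ 0)
    (h : Complex.exp (2 * s) = (1 + z) / (1 - z)) :
    Dm m z * Complex.cosh s =
      2 * (Complex.sinh (m * s) * Complex.sinh (((m + 1 : ℝ) : ℂ) * s)) := by
  have hsinh : Complex.sinh s = z * Complex.cosh s := by
    have he : Complex.exp s * Complex.exp s * (1 - z) = 1 + z := by
      rw [← Complex.exp_add, ← two_mul, h, div_mul_cancel₀ _ hz]
    have hi : Complex.exp s * Complex.exp (-s) = 1 := by
      rw [← Complex.exp_add, add_neg_cancel, Complex.exp_zero]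
    refine mul_left_cancel₀ (Complex.exp_ne_zero s) ?_
    rw [Complex.sinh, Complex.cosh]
    linear_combination he / 2 - (1 + z) / 2 * hi
  have h1 : ((1 + z) / (1 - z)) ^ m = Complex.exp (m * s) ^ 2 := by
    rw [← h, ← Complex.exp_nat_mul, ← Complex.exp_nat_mul]
    congr 1
    push_cast
    ring
  have h2 : ((1 - z) / (1 + z)) ^ m = Complex.exp (-(m * s)) ^ 2 := by
    rw [← inv_div, inv_pow, h1, Complex.exp_neg, inv_pow]
  have h3 : Dm m z = 2 * Complex.sinh (m * s) *
      (Complex.sinh (m * s) + z * Complex.cosh (m * s)) := by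
    have hi : Complex.exp (m * s) * Complex.exp (-(m * s)) = 1 := by
      rw [← Complex.exp_add, add_neg_cancel, Complex.exp_zero]
    rw [Dm, h1, h2, Complex.sinh, Complex.cosh]
    linear_combination hi
  have h4 : ((m + 1 : ℝ) : ℂ) * s = m * s + s := by
    push_cast
    ring
  rw [h3, h4, Complex.sinh_add, hsinh]
  ring

/-- Bounds for `cosh s` when `s = artanh z` and `|z| ≤ 1/2`. -/
lemma norm_cosh_bounds {z s : ℂ} (hz : ‖z‖ ≤ 1 / 2)
    (h : Complex.exp (2 * s) = (1 + z) / (1 - z)) :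
    1 / 2 ≤ ‖Complex.cosh s‖ ∧ ‖Complex.cosh s‖ ≤ 2 := by
  have hz1 : 1 - z ≠ 0 := by
    intro h0
    rw [← sub_eq_zero.1 h0, norm_one] at hz
    norm_num at hz
  have hc : Complex.cosh s ^ 2 * (1 - z ^ 2) = 1 := by
    have he : Complex.exp s * Complex.exp s * (1 - z) = 1 + z := by
      rw [← Complex.exp_add, ← two_mul, h, div_mul_cancel₀ _ hz1]
    have hi : Complex.exp s * Complex.exp (-s) = 1 := by
      rw [← Complex.exp_add, add_neg_cancel, Complex.exp_zero]
    have hcs : Complex.exp s * Complex.cosh s * (1 - z) = 1 := by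
      rw [Complex.cosh]
      linear_combination he / 2 + (1 - z) / 2 * hi
    linear_combination (Complex.exp s * Complex.cosh s * (1 - z) + 1) * hcs
      - Complex.cosh s ^ 2 * (1 - z) * he
  have hn : ‖Complex.cosh s‖ ^ 2 * ‖1 - z ^ 2‖ = 1 := by
    rw [← norm_pow, ← norm_mul, hc, norm_one]
  have hzz : ‖z ^ 2‖ ≤ 1 / 4 := by
    rw [norm_pow]
    nlinarith [norm_nonneg z]
  have hu : ‖1 - z ^ 2‖ ≤ 5 / 4 := by
    have := norm_sub_le 1 (z ^ 2)
    rw [norm_one] at this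
    linarith
  have hl : 3 / 4 ≤ ‖1 - z ^ 2‖ := by
    have := norm_sub_norm_le 1 (z ^ 2)
    rw [norm_one] at this
    linarith
  have h0 := norm_nonneg (Complex.cosh s)
  constructor
  · nlinarith [mul_le_mul_of_nonneg_left hu (sq_nonneg ‖Complex.cosh s‖)]
  · nlinarith [mul_le_mul_of_nonneg_left hl (sq_nonneg ‖Complex.cosh s‖)]

/-- A logarithmic inverse hyperbolic tangent close to the identity on the half disc. -/
lemma exists_exp_two_mul_eq {z : ℂ} (hz : ‖z‖ ≤ 1 / 2) :
    ∃ s : ℂ, Complex.exp (2 * s) = (1 + z) / (1 - z) ∧ ‖s - z‖ ≤ ‖z‖ ^ 2 := by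
  have key : ∀ w : ℂ, ‖w‖ ≤ 1 / 2 → 1 + w ≠ 0 ∧ ‖Complex.log (1 + w) - w‖ ≤ ‖w‖ ^ 2 := by
    intro w hw
    constructor
    · intro h0
      rw [eq_neg_of_add_eq_zero_right h0, norm_neg, norm_one] at hw
      norm_num at hw
    · refine (Complex.norm_log_one_add_sub_self_le (by linarith)).trans ?_
      have : (1 - ‖w‖)⁻¹ ≤ 2 := inv_le_of_inv_le₀ (by norm_num) (by linarith)
      nlinarith [mul_le_mul_of_nonneg_left this (sq_nonneg ‖w‖)]
  obtain ⟨hp, hp'⟩ := key z hz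
  obtain ⟨hq, hq'⟩ := key (-z) (by rwa [norm_neg])
  rw [norm_neg] at hq'
  refine ⟨(Complex.log (1 + z) - Complex.log (1 + -z)) / 2, ?_, ?_⟩
  · rw [mul_div_cancel₀ _ two_ne_zero, Complex.exp_sub, Complex.exp_log hp, Complex.exp_log hq,
      sub_eq_add_neg]
  · have h : (Complex.log (1 + z) - Complex.log (1 + -z)) / 2 - z
        = ((Complex.log (1 + z) - z) - (Complex.log (1 + -z) - -z)) / 2 := by ring
    rw [h, norm_div, Complex.norm_ofNat]
    linarith [norm_sub_le (Complex.log (1 + z) - z) (Complex.log (1 + -z) - -z)]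

/-- If `s = artanh z` lies in the wedge `|Im s| ≤ C Re s`, then `D_m(z)` is comparable to
`sinh² (m Re s)`. -/
lemma Dm_bounds_of_exp_eq {C : ℝ} (hC : 0 ≤ C) {z s : ℂ} (hz : ‖z‖ ≤ 1 / 2)
    (h : Complex.exp (2 * s) = (1 + z) / (1 - z)) (hs : 0 ≤ s.re) (hs1 : s.re ≤ 1)
    (him : |s.im| ≤ C * s.re) {m : ℕ} (hm : 1 ≤ m) :
    Real.sinh (m * s.re) ^ 2 ≤ ‖Dm m z‖ ∧
      ‖Dm m z‖ ≤ 24 * (1 + C) ^ 2 * Real.sinh (m * s.re) ^ 2 := by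
  have hm' : (1 : ℝ) ≤ m := by exact_mod_cast hm
  have hz1 : 1 - z ≠ 0 := by
    intro h0
    rw [← sub_eq_zero.1 h0, norm_one] at hz
    norm_num at hz
  obtain ⟨hc1, hc2⟩ := norm_cosh_bounds hz h
  have hD := congrArg norm (Dm_mul_cosh m hz1 h)
  rw [norm_mul, norm_mul, norm_mul, Complex.norm_ofNat, ← Complex.ofReal_natCast] at hD
  have hlow : ∀ t : ℝ, Real.sinh (t * s.re) ≤ ‖Complex.sinh ((t : ℂ) * s)‖ := fun t ↦ by
    simpa using sinh_re_le_norm_sinh ((t : ℂ) * s)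
  have hup : ∀ t : ℝ, 0 ≤ t →
      ‖Complex.sinh ((t : ℂ) * s)‖ ≤ (1 + C) * Real.sinh (t * s.re) := fun t ht ↦ by
    have := norm_sinh_le hC (s := (t : ℂ) * s) (by simpa using mul_nonneg ht hs)
      (by
        simp only [Complex.im_ofReal_mul, Complex.re_ofReal_mul, abs_mul, abs_of_nonneg ht]
        nlinarith)
    simpa using this
  have hS : 0 ≤ Real.sinh (m * s.re) := Real.sinh_nonneg_iff.2 (by positivity)
  have hmono : Real.sinh (m * s.re) ≤ Real.sinh ((m + 1) * s.re) :=
    Real.sinh_le_sinh.2 (by nlinarith)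
  have hcosh : Real.cosh s.re ≤ 3 := by
    rw [Real.cosh_eq]
    have h1 : Real.exp s.re ≤ 3 :=
      (Real.exp_le_exp.2 hs1).trans (by linarith [Real.exp_one_lt_d9])
    have h2 : Real.exp (-s.re) ≤ 1 := Real.exp_le_one_iff.2 (by linarith)
    linarith
  have hadd : Real.sinh ((m + 1) * s.re) ≤ 6 * Real.sinh (m * s.re) := by
    nlinarith [sinh_add_one_mul_le hm' hs]
  constructor
  · have := mul_le_mul (hlow m) (hmono.trans (hlow (m + 1))) hS (norm_nonneg _)
    nlinarith [norm_nonneg (Dm m z)]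
  · have h1 : ‖Complex.sinh (((m + 1 : ℝ) : ℂ) * s)‖
        ≤ (1 + C) * (6 * Real.sinh (m * s.re)) :=
      (hup (m + 1) (by positivity)).trans (by gcongr)
    have := mul_le_mul (hup m (by positivity)) h1 (norm_nonneg _) (by positivity)
    nlinarith [norm_nonneg (Dm m z)]

/-- Let `a > 0` and `0 < ε < 1`. There are positive constants `K₁, m₀` depending only on `a`,
and `δ₀ > 0` depending on `a` and `ε`, such that for all `z = x + iy ∈ V_a` with `|z| ≤ δ₀`
and all `m ≥ m₀`, `sinh²((1−ε)mx) ≤ |D_m(z)| ≤ K₁ sinh²((1+ε)mx)`. -/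
theorem Dm_bounds_on_wedge (a : ℝ) (ha : 0 < a) :
    ∃ K₁ : ℝ, 0 < K₁ ∧ ∃ m₀ : ℕ, 0 < m₀ ∧
      ∀ ε : ℝ, 0 < ε → ε < 1 →
        ∃ δ₀ : ℝ, 0 < δ₀ ∧
          ∀ z : ℂ, z ∈ wedge a → ‖z‖ ≤ δ₀ → ∀ m : ℕ, m₀ ≤ m →
            Real.sinh ((1 - ε) * (m : ℝ) * z.re) ^ 2 ≤ ‖Dm m z‖ ∧
            ‖Dm m z‖ ≤ K₁ * Real.sinh ((1 + ε) * (m : ℝ) * z.re) ^ 2 := by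
  refine ⟨24 * (1 + (2 * a + 1)) ^ 2, by positivity, 1, one_pos, fun ε hε hε1 ↦
    ⟨min ε (1 / 2) / (1 + a), by positivity, fun z hz hzδ m hm ↦ ?_⟩⟩
  obtain ⟨hx, hy⟩ := hz
  have hδ : ‖z‖ * (1 + a) ≤ min ε (1 / 2) := (le_div_iff₀ (by positivity)).1 hzδ
  have hz0 := norm_nonneg z
  have hδ1 : ‖z‖ * (1 + a) ≤ ε := hδ.trans (min_le_left _ _)
  have hδ2 : ‖z‖ * (1 + a) ≤ 1 / 2 := hδ.trans (min_le_right _ _)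
  have hz2 : ‖z‖ ≤ 1 / 2 := by nlinarith
  have hzx : ‖z‖ ≤ (1 + a) * z.re := by
    have := Complex.norm_le_abs_re_add_abs_im z
    rw [abs_of_pos hx] at this
    linarith
  obtain ⟨s, hs, hsz⟩ := exists_exp_two_mul_eq hz2
  have hd : ‖s - z‖ ≤ ‖z‖ * (1 + a) * z.re := by nlinarith
  have hre := abs_le.1 ((Complex.abs_re_le_norm (s - z)).trans hd)
  have him := abs_le.1 ((Complex.abs_im_le_norm (s - z)).trans hd)
  rw [Complex.sub_re] at hre
  rw [Complex.sub_im] at him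
  have he1 := mul_le_mul_of_nonneg_right hδ1 hx.le
  have he2 := mul_le_mul_of_nonneg_right hδ2 hx.le
  have hy' := abs_lt.1 hy
  have hxz : z.re ≤ 1 / 2 := (Complex.re_le_norm z).trans hz2
  obtain ⟨hl, hu⟩ := Dm_bounds_of_exp_eq (C := 2 * a + 1) (by positivity) hz2 hs
    (by linarith) (by linarith)
    (abs_le.2 ⟨by nlinarith, by nlinarith⟩) hm
  have hm0 : (0 : ℝ) ≤ m := Nat.cast_nonneg m
  constructor
  · refine le_trans (pow_le_pow_left₀ (Real.sinh_nonneg_iff.2 ?_) (Real.sinh_le_sinh.2 ?_) 2) hl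
    · have : 0 ≤ 1 - ε := by linarith
      positivity
    · nlinarith
  · refine hu.trans (mul_le_mul_of_nonneg_left
      (pow_le_pow_left₀ (Real.sinh_nonneg_iff.2 ?_) (Real.sinh_le_sinh.2 ?_) 2) (by positivity))
    · exact mul_nonneg hm0 (by linarith)
    · nlinarith
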